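/- arXiv:2506.18408 — 5 statements merged into one kernel-verified Lean document; each statement's English description precedes it below -/
import Mathlib

section
/- Let A be an n×n real matrix, b, x₀ ∈ ℝⁿ, r₀ = b - A·x₀, β = ‖r₀‖ with β ≠ 0, and v₁ = r₀/β. Suppose z₁ ∈ ℝⁿ satisfies A·z₁ = v₁ - r̂₁ for some vector r̂₁ ∈ ℝⁿ (i.e., the inner solver returns z₁ with residual r̂₁ for the system A·z = v₁). Then the minimal residual over the one-dimensional search space spanned by z₁ satisfies: for every real γ one has inf over γ' ∈ ℝ of ‖b - A·(x₀ + γ'·z₁)‖ ≤ β·‖r̂₁‖. In particular the first FGMRES iterate x₁, which minimizes ‖b - A·(x₀ + γ·z₁)‖ over γ ∈ ℝ, satisfies ‖b - A·x₁‖ ≤ ‖r₀‖·‖r̂₁‖. -/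
/-- First FGMRES iteration: if `r₀ = b - A·x₀`, `β = ‖r₀‖ ≠ 0`, `v₁ = r₀/β`, and the inner
solver returns `z₁` with `A·z₁ = v₁ - r̂₁`, then the minimal residual over the span of `z₁`
satisfies `inf_{γ'} ‖b - A·(x₀ + γ'·z₁)‖ ≤ β·‖r̂₁‖`; in particular any minimizer `x₁`
satisfies `‖b - A·x₁‖ ≤ ‖r₀‖·‖r̂₁‖`. (All norms are Euclidean.) -/
theorem fgmres_first_step_bound
    (n : ℕ)
    (A : Matrix (Fin n) (Fin n) ℝ) (b x₀ : Fin n → ℝ)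
    (r₀ : Fin n → ℝ) (hr₀ : r₀ = b - A.mulVec x₀)
    (β : ℝ) (hβ : β = ‖(EuclideanSpace.equiv (Fin n) ℝ).symm r₀‖) (hβ0 : β ≠ 0)
    (v₁ : Fin n → ℝ) (hv₁ : v₁ = β⁻¹ • r₀)
    (z₁ rhat₁ : Fin n → ℝ) (hz₁ : A.mulVec z₁ = v₁ - rhat₁) :
    (⨅ γ' : ℝ, ‖(EuclideanSpace.equiv (Fin n) ℝ).symm (b - A.mulVec (x₀ + γ' • z₁))‖)
      ≤ β * ‖(EuclideanSpace.equiv (Fin n) ℝ).symm rhat₁‖ ∧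
    ∀ x₁ : Fin n → ℝ, (∃ γ₁ : ℝ, x₁ = x₀ + γ₁ • z₁) →
      (∀ γ : ℝ, ‖(EuclideanSpace.equiv (Fin n) ℝ).symm (b - A.mulVec x₁)‖
          ≤ ‖(EuclideanSpace.equiv (Fin n) ℝ).symm (b - A.mulVec (x₀ + γ • z₁))‖) →
      ‖(EuclideanSpace.equiv (Fin n) ℝ).symm (b - A.mulVec x₁)‖
        ≤ ‖(EuclideanSpace.equiv (Fin n) ℝ).symm r₀‖
          * ‖(EuclideanSpace.equiv (Fin n) ℝ).symm rhat₁‖ := by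
  have hvec : b - A.mulVec (x₀ + β • z₁) = β • rhat₁ := by
    rw [Matrix.mulVec_add, Matrix.mulVec_smul, hz₁, hv₁, smul_sub, smul_smul,
      mul_inv_cancel₀ hβ0, one_smul, hr₀]
    abel
  have hβnn : 0 ≤ β := by rw [hβ]; exact norm_nonneg _
  have key : ‖(EuclideanSpace.equiv (Fin n) ℝ).symm (b - A.mulVec (x₀ + β • z₁))‖
      = β * ‖(EuclideanSpace.equiv (Fin n) ℝ).symm rhat₁‖ := by
    rw [hvec, map_smul, norm_smul, Real.norm_of_nonneg hβnn]
  refine ⟨?_, ?_⟩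
  · rw [← key]
    exact ciInf_le (f := fun γ' : ℝ =>
      ‖(EuclideanSpace.equiv (Fin n) ℝ).symm (b - A.mulVec (x₀ + γ' • z₁))‖)
      ⟨0, by rintro _ ⟨γ, rfl⟩; exact norm_nonneg _⟩ β
  · intro x₁ _ hmin
    have h := hmin β
    rw [key] at h
    rw [← hβ]
    exact h
end

section
/- Let A be an n×n real matrix, b, x₀ ∈ ℝⁿ, and r₀ = b - A·x₀. Suppose A·Z = V·H̲ where Z is an n×(m-1) real matrix, V is an n×m real matrix, and H̲ is an m×(m-1) real matrix whose last row vanishes except possibly in its last entry h := H̲(m, m-1). Let H denote the top (m-1)×(m-1) block of H̲ and assume H is invertible. Assume r₀ = β·(V·e₁) for a real scalar β. Suppose z_m ∈ ℝⁿ satisfies A·z_m = V·e_m - r̂_m for some vector r̂_m ∈ ℝⁿ, where e_m is the m-th standard basis vector of ℝᵐ. Define c = H⁻¹·(β·e₁) ∈ ℝ^{m-1}, let γ_{m-1} be the last entry of c, and set γ_m = -h·γ_{m-1}. Then b - A·(x₀ + Z·c + γ_m·z_m) = γ_m·r̂_m. -/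
/-- FGMRES step-m residual identity with a special coefficient choice: with the Arnoldi-like
decomposition `A·Z = V·H̲` (`Z ∈ ℝ^{n×(m-1)}`, `V ∈ ℝ^{n×m}`, `H̲ ∈ ℝ^{m×(m-1)}`, last row of
`H̲` vanishing except possibly in its last entry `h`), `H` invertible, `r₀ = β·(V·e₁)`, and
`A·z_m = V·e_m - r̂_m`, setting `c = H⁻¹·(β·e₁)`, `γ_{m-1}` its last entry, and
`γ_m = -h·γ_{m-1}`, one has `b - A·(x₀ + Z·c + γ_m·z_m) = γ_m·r̂_m`. -/
theorem fgmres_special_coefficients_residual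
    (n m : ℕ) (hm : 2 ≤ m)
    (A : Matrix (Fin n) (Fin n) ℝ) (b x₀ : Fin n → ℝ)
    (Z : Matrix (Fin n) (Fin (m - 1)) ℝ) (V : Matrix (Fin n) (Fin m) ℝ)
    (Hbar : Matrix (Fin m) (Fin (m - 1)) ℝ)
    (hAZ : A * Z = V * Hbar)
    (hlastrow : ∀ j : Fin (m - 1), j ≠ ⟨m - 2, by omega⟩ → Hbar ⟨m - 1, by omega⟩ j = 0)
    (H : Matrix (Fin (m - 1)) (Fin (m - 1)) ℝ)
    (hH : ∀ i j : Fin (m - 1), H i j = Hbar ⟨i.1, by omega⟩ j)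
    (hHinv : IsUnit H.det)
    (β : ℝ)
    (hr₀ : b - A.mulVec x₀ = β • V.mulVec (Pi.single (⟨0, by omega⟩ : Fin m) 1))
    (zm rhatm : Fin n → ℝ)
    (hzm : A.mulVec zm = V.mulVec (Pi.single (⟨m - 1, by omega⟩ : Fin m) 1) - rhatm)
    (h : ℝ) (hh : h = Hbar ⟨m - 1, by omega⟩ ⟨m - 2, by omega⟩)
    (c : Fin (m - 1) → ℝ)
    (hc : c = H⁻¹.mulVec (β • (Pi.single (⟨0, by omega⟩ : Fin (m - 1)) 1 : Fin (m - 1) → ℝ)))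
    (γ γm : ℝ) (hγ : γ = c ⟨m - 2, by omega⟩) (hγm : γm = -(h * γ)) :
    b - A.mulVec (x₀ + Z.mulVec c + γm • zm) = γm • rhatm := by
  have hHc : H.mulVec c = β • (Pi.single (⟨0, by omega⟩ : Fin (m - 1)) 1 : Fin (m - 1) → ℝ) := by
    rw [hc, Matrix.mulVec_mulVec, Matrix.mul_nonsing_inv _ hHinv, Matrix.one_mulVec]
  have key : Hbar.mulVec c = β • (Pi.single (⟨0, by omega⟩ : Fin m) 1 : Fin m → ℝ)
      + (h * γ) • (Pi.single (⟨m - 1, by omega⟩ : Fin m) 1 : Fin m → ℝ) := by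
    funext i
    by_cases hi : i.1 = m - 1
    · have hi' : i = ⟨m - 1, Nat.sub_lt (by omega) Nat.one_pos⟩ := Fin.ext hi
      rw [hi']
      have h0 : (⟨m - 1, by omega⟩ : Fin m) ≠ ⟨0, by omega⟩ := by
        intro h1
        have := congrArg Fin.val h1
        simp only at this
        omega
      simp only [Pi.add_apply, Pi.smul_apply, Pi.single_eq_same, Pi.single_eq_of_ne h0,
        smul_eq_mul, mul_zero, mul_one, zero_add]
      rw [hh, hγ]
      simp only [Matrix.mulVec, dotProduct]
      apply Finset.sum_eq_single_of_mem _ (Finset.mem_univ _)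
      intro j _ hj
      rw [hlastrow j hj, zero_mul]
    · have h1 := congrFun hHc ⟨i.1, by omega⟩
      have h2 : H.mulVec c ⟨i.1, by omega⟩ = Hbar.mulVec c i := by
        simp only [Matrix.mulVec, dotProduct, hH]
      rw [← h2, h1]
      have h3 : i ≠ ⟨m - 1, by omega⟩ := fun h4 => hi (congrArg Fin.val h4)
      simp [Pi.single_apply, Fin.ext_iff, hi]
  have hb : b = A.mulVec x₀ + β • V.mulVec (Pi.single (⟨0, by omega⟩ : Fin m) 1) := by
    rw [← hr₀]; abel
  rw [Matrix.mulVec_add, Matrix.mulVec_add, Matrix.mulVec_smul, hzm, Matrix.mulVec_mulVec, hAZ,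
    ← Matrix.mulVec_mulVec, key, Matrix.mulVec_add, Matrix.mulVec_smul, Matrix.mulVec_smul, hγm]
  rw [hb]
  module
end

section
/- Let A be an n×n real matrix, b, x₀ ∈ ℝⁿ, and r₀ = b - A·x₀. Suppose A·Z = V·H̲ where Z is an n×(m-1) real matrix, V is an n×m real matrix, and H̲ is an m×(m-1) real matrix whose last row vanishes except possibly in its last entry h := H̲(m, m-1). Let H denote the top (m-1)×(m-1) block of H̲ and assume H is invertible. Assume r₀ = β·(V·e₁) for a real scalar β. Suppose z_m ∈ ℝⁿ satisfies A·z_m = V·e_m - r̂_m for some vector r̂_m ∈ ℝⁿ. Let γ_{m-1} denote the last entry of H⁻¹·(β·e₁) ∈ ℝ^{m-1}. Then the FGMRES residual at step m, namely the infimum over all y ∈ ℝ^{m-1} and γ ∈ ℝ of ‖b - A·(x₀ + Z·y + γ·z_m)‖, is at most |h|·|γ_{m-1}|·‖r̂_m‖. -/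
/-- FGMRES residual bound at step m: under the Arnoldi-like decomposition `A·Z = V·H̲`
(last row of `H̲` vanishing except possibly in its last entry `h`), `H` invertible,
`r₀ = β·(V·e₁)` and `A·z_m = V·e_m - r̂_m`, the FGMRES residual
`inf_{y,γ} ‖b - A·(x₀ + Z·y + γ·z_m)‖` is at most `|h|·|γ_{m-1}|·‖r̂_m‖`, where `γ_{m-1}`
is the last entry of `H⁻¹·(β·e₁)`. (All norms are Euclidean.) -/
theorem fgmres_residual_bound
    (n m : ℕ) (hm : 2 ≤ m)
    (A : Matrix (Fin n) (Fin n) ℝ) (b x₀ : Fin n → ℝ)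
    (Z : Matrix (Fin n) (Fin (m - 1)) ℝ) (V : Matrix (Fin n) (Fin m) ℝ)
    (Hbar : Matrix (Fin m) (Fin (m - 1)) ℝ)
    (hAZ : A * Z = V * Hbar)
    (hlastrow : ∀ j : Fin (m - 1), j ≠ ⟨m - 2, by omega⟩ → Hbar ⟨m - 1, by omega⟩ j = 0)
    (H : Matrix (Fin (m - 1)) (Fin (m - 1)) ℝ)
    (hH : ∀ i j : Fin (m - 1), H i j = Hbar ⟨i.1, by omega⟩ j)
    (hHinv : IsUnit H.det)
    (β : ℝ)
    (hr₀ : b - A.mulVec x₀ = β • V.mulVec (Pi.single (⟨0, by omega⟩ : Fin m) 1))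
    (zm rhatm : Fin n → ℝ)
    (hzm : A.mulVec zm = V.mulVec (Pi.single (⟨m - 1, by omega⟩ : Fin m) 1) - rhatm)
    (h : ℝ) (hh : h = Hbar ⟨m - 1, by omega⟩ ⟨m - 2, by omega⟩)
    (γ : ℝ)
    (hγ : γ = H⁻¹.mulVec (β • (Pi.single (⟨0, by omega⟩ : Fin (m - 1)) 1 : Fin (m - 1) → ℝ))
      ⟨m - 2, by omega⟩) :
    (⨅ p : (Fin (m - 1) → ℝ) × ℝ,
        ‖(EuclideanSpace.equiv (Fin n) ℝ).symm (b - A.mulVec (x₀ + Z.mulVec p.1 + p.2 • zm))‖)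
      ≤ |h| * |γ| * ‖(EuclideanSpace.equiv (Fin n) ℝ).symm rhatm‖ := by
  set y : Fin (m - 1) → ℝ :=
    H⁻¹.mulVec (β • (Pi.single (⟨0, by omega⟩ : Fin (m - 1)) 1 : Fin (m - 1) → ℝ)) with hy
  have hHy : H.mulVec y = β • (Pi.single (⟨0, by omega⟩ : Fin (m - 1)) 1 : Fin (m - 1) → ℝ) := by
    rw [hy, Matrix.mulVec_mulVec, Matrix.mul_nonsing_inv _ hHinv, Matrix.one_mulVec]
  have hHb : Hbar.mulVec y = β • (Pi.single (⟨0, by omega⟩ : Fin m) 1 : Fin m → ℝ)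
      + (h * γ) • (Pi.single (⟨m - 1, by omega⟩ : Fin m) 1 : Fin m → ℝ) := by
    funext i
    by_cases hi : i.1 < m - 1
    · have h1 := congrFun hHy ⟨i.1, hi⟩
      have h2 : Hbar.mulVec y i = H.mulVec y ⟨i.1, hi⟩ := by
        simp only [Matrix.mulVec, dotProduct, hH]
      rw [h2, h1]
      have h3 : i ≠ ⟨m - 1, by omega⟩ := by
        intro h4
        have := congrArg Fin.val h4
        simp only at this
        omega
      simp [Pi.single_apply, h3, Fin.ext_iff]
    · have h3 : i = ⟨m - 1, by omega⟩ := by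
        apply Fin.ext
        simp only
        omega
      rw [h3]
      have h6 : (⟨m - 1, by omega⟩ : Fin m) ≠ ⟨0, by omega⟩ := by
        intro h4
        have := congrArg Fin.val h4
        simp only at this
        omega
      simp only [Matrix.mulVec, dotProduct, Pi.add_apply, Pi.smul_apply, Pi.single_eq_same,
        Pi.single_eq_of_ne h6, smul_eq_mul, mul_zero, zero_add, mul_one]
      rw [Finset.sum_eq_single (⟨m - 2, by omega⟩ : Fin (m - 1)), hh, hγ]
      · intro j _ hj
        rw [hlastrow j hj, zero_mul]
      · intro hj
        exact absurd (Finset.mem_univ _) hj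
  have key : b - A.mulVec (x₀ + Z.mulVec y + (-(h * γ)) • zm) = (-(h * γ)) • rhatm := by
    rw [Matrix.mulVec_add, Matrix.mulVec_add, Matrix.mulVec_smul, hzm, Matrix.mulVec_mulVec, hAZ,
      ← Matrix.mulVec_mulVec, hHb, Matrix.mulVec_add, Matrix.mulVec_smul, Matrix.mulVec_smul,
      ← hr₀]
    module
  refine (ciInf_le ⟨0, ?_⟩ (y, -(h * γ))).trans ?_
  · rintro _ ⟨p, rfl⟩
    exact norm_nonneg _
  · simp only
    rw [key, map_smul, norm_smul, Real.norm_eq_abs, abs_neg, abs_mul]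
end

section
/- Let A be an n×n real matrix, b, x₀ ∈ ℝⁿ, and r₀ = b - A·x₀. Suppose A·Z = V·H̲ where Z is an n×(m-1) real matrix, V is an n×m real matrix, and H̲ is an m×(m-1) real matrix whose last row vanishes except possibly in its last entry h := H̲(m, m-1). Let H denote the top (m-1)×(m-1) block of H̲, assume H is invertible, assume r₀ = β·(V·e₁) for a real scalar β, and assume the m-th column v_m = V·e_m of V has Euclidean norm 1. Suppose z_m ∈ ℝⁿ satisfies A·z_m = v_m - r̂_m for some r̂_m ∈ ℝⁿ. Let x̃_{m-1} = x₀ + Z·(H⁻¹·(β·e₁)) be the flexible FOM iterate at step m-1. Then the FGMRES residual at step m satisfies: the infimum over all y ∈ ℝ^{m-1} and γ ∈ ℝ of ‖b - A·(x₀ + Z·y + γ·z_m)‖ is at most ‖b - A·x̃_{m-1}‖·‖r̂_m‖. -/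
/-- FGMRES residual bound via the FFOM residual: under the Arnoldi-like decomposition
`A·Z = V·H̲` (last row of `H̲` vanishing except possibly in its last entry `h`), `H`
invertible, `r₀ = β·(V·e₁)`, `‖v_m‖ = 1`, and `A·z_m = v_m - r̂_m`, the FGMRES residual
`inf_{y,γ} ‖b - A·(x₀ + Z·y + γ·z_m)‖` is at most `‖b - A·x̃_{m-1}‖·‖r̂_m‖`, where
`x̃_{m-1} = x₀ + Z·(H⁻¹·(β·e₁))` is the flexible FOM iterate. (All norms are Euclidean.) -/
theorem fgmres_residual_bound_ffom
    (n m : ℕ) (hm : 2 ≤ m)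
    (A : Matrix (Fin n) (Fin n) ℝ) (b x₀ : Fin n → ℝ)
    (Z : Matrix (Fin n) (Fin (m - 1)) ℝ) (V : Matrix (Fin n) (Fin m) ℝ)
    (Hbar : Matrix (Fin m) (Fin (m - 1)) ℝ)
    (hAZ : A * Z = V * Hbar)
    (hlastrow : ∀ j : Fin (m - 1), j ≠ ⟨m - 2, by omega⟩ → Hbar ⟨m - 1, by omega⟩ j = 0)
    (H : Matrix (Fin (m - 1)) (Fin (m - 1)) ℝ)
    (hH : ∀ i j : Fin (m - 1), H i j = Hbar ⟨i.1, by omega⟩ j)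
    (hHinv : IsUnit H.det)
    (β : ℝ)
    (hr₀ : b - A.mulVec x₀ = β • V.mulVec (Pi.single (⟨0, by omega⟩ : Fin m) 1))
    (hv : ‖(EuclideanSpace.equiv (Fin n) ℝ).symm
        (V.mulVec (Pi.single (⟨m - 1, by omega⟩ : Fin m) 1))‖ = 1)
    (zm rhatm : Fin n → ℝ)
    (hzm : A.mulVec zm = V.mulVec (Pi.single (⟨m - 1, by omega⟩ : Fin m) 1) - rhatm)
    (xfprev : Fin n → ℝ)
    (hxfprev : xfprev = x₀ +
      Z.mulVec (H⁻¹.mulVec (β • (Pi.single (⟨0, by omega⟩ : Fin (m - 1)) 1 : Fin (m - 1) → ℝ)))) :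
    (⨅ p : (Fin (m - 1) → ℝ) × ℝ,
        ‖(EuclideanSpace.equiv (Fin n) ℝ).symm (b - A.mulVec (x₀ + Z.mulVec p.1 + p.2 • zm))‖)
      ≤ ‖(EuclideanSpace.equiv (Fin n) ℝ).symm (b - A.mulVec xfprev)‖
        * ‖(EuclideanSpace.equiv (Fin n) ℝ).symm rhatm‖ := by
  set y := H⁻¹.mulVec (β • (Pi.single (⟨0, by omega⟩ : Fin (m - 1)) 1 : Fin (m - 1) → ℝ)) with hy
  have hHy : H.mulVec y = β • (Pi.single (⟨0, by omega⟩ : Fin (m - 1)) 1 : Fin (m - 1) → ℝ) := by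
    rw [hy, Matrix.mulVec_mulVec, Matrix.mul_nonsing_inv _ hHinv, Matrix.one_mulVec]
  set s : ℝ := Hbar.mulVec y ⟨m - 1, by omega⟩ with hs
  set v := V.mulVec (Pi.single (⟨m - 1, by omega⟩ : Fin m) 1) with hvdef
  have hHbar : Hbar.mulVec y = β • (Pi.single (⟨0, by omega⟩ : Fin m) 1 : Fin m → ℝ)
      + s • (Pi.single (⟨m - 1, by omega⟩ : Fin m) 1 : Fin m → ℝ) := by
    funext i
    by_cases hi : i.1 = m - 1
    · have hi' : i = ⟨m - 1, by omega⟩ := Fin.ext hi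
      have h0 : (⟨m - 1, by omega⟩ : Fin m) ≠ ⟨0, by omega⟩ := by
        intro h
        have := congrArg Fin.val h
        simp at this
        omega
      rw [hi', ← hs]
      simp [Pi.single_apply, h0]
    · have hlt : i.1 < m - 1 := by omega
      have h1 := congrFun hHy ⟨i.1, hlt⟩
      have h2 : H.mulVec y ⟨i.1, hlt⟩ = Hbar.mulVec y i := by
        simp only [Matrix.mulVec, dotProduct, hH]
      rw [← h2, h1]
      simp [Pi.single_apply, Fin.ext_iff, hi]
  have hAx : b - A.mulVec xfprev = (-s) • v := by
    rw [hxfprev, Matrix.mulVec_add, ← sub_sub, hr₀, Matrix.mulVec_mulVec, hAZ,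
      ← Matrix.mulVec_mulVec, hHbar, Matrix.mulVec_add, Matrix.mulVec_smul, Matrix.mulVec_smul]
    simp [hvdef]
  have hres : b - A.mulVec (x₀ + Z.mulVec y + (-s) • zm) = (-s) • rhatm := by
    rw [Matrix.mulVec_add, ← sub_sub, ← hxfprev, hAx, Matrix.mulVec_smul, hzm, smul_sub]
    abel
  refine (ciInf_le ⟨0, ?_⟩ (y, -s)).trans ?_
  · rintro _ ⟨p, rfl⟩
    exact norm_nonneg _
  · simp only [hres, hAx, map_smul, norm_smul, hv, mul_one, le_refl]
end

section
/- Let A be an n×n real matrix, b, x₀ ∈ ℝⁿ, and r₀ = b - A·x₀. Suppose A·Z = V·H̲ where Z is an n×(m-1) real matrix, V is an n×m real matrix, and H̲ is an m×(m-1) real matrix whose last row vanishes except possibly in its last entry h := H̲(m, m-1). Let H denote the top (m-1)×(m-1) block of H̲ and assume H is invertible. Assume r₀ = β·(V·e₁) for a real scalar β. Suppose the inner solve at step m is exact, i.e., z_m ∈ ℝⁿ satisfies A·z_m = V·e_m. Then the exact solution lies in the FGMRES search space: there exist y ∈ ℝ^{m-1} and γ ∈ ℝ such that b = A·(x₀ +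 Z·y + γ·z_m). -/
/-- Exact inner solve gives an exact FGMRES iterate: under the Arnoldi-like decomposition
`A·Z = V·H̲` (last row of `H̲` vanishing except possibly in its last entry), `H` invertible,
`r₀ = β·(V·e₁)`, and an exact inner solve `A·z_m = V·e_m`, the exact solution lies in the
FGMRES search space: `b = A·(x₀ + Z·y + γ·z_m)` for some `y` and `γ`. -/
theorem fgmres_exact_inner_solve
    (n m : ℕ) (hm : 2 ≤ m)
    (A : Matrix (Fin n) (Fin n) ℝ) (b x₀ : Fin n → ℝ)
    (Z : Matrix (Fin n) (Fin (m - 1)) ℝ) (V : Matrix (Fin n) (Fin m) ℝ)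
    (Hbar : Matrix (Fin m) (Fin (m - 1)) ℝ)
    (hAZ : A * Z = V * Hbar)
    (hlastrow : ∀ j : Fin (m - 1), j ≠ ⟨m - 2, by omega⟩ → Hbar ⟨m - 1, by omega⟩ j = 0)
    (H : Matrix (Fin (m - 1)) (Fin (m - 1)) ℝ)
    (hH : ∀ i j : Fin (m - 1), H i j = Hbar ⟨i.1, by omega⟩ j)
    (hHinv : IsUnit H.det)
    (β : ℝ)
    (hr₀ : b - A.mulVec x₀ = β • V.mulVec (Pi.single (⟨0, by omega⟩ : Fin m) 1))
    (zm : Fin n → ℝ)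
    (hzm : A.mulVec zm = V.mulVec (Pi.single (⟨m - 1, by omega⟩ : Fin m) 1)) :
    ∃ (y : Fin (m - 1) → ℝ) (γ : ℝ), b = A.mulVec (x₀ + Z.mulVec y + γ • zm) := by
  obtain ⟨y, hy⟩ : ∃ y : Fin (m - 1) → ℝ,
      H.mulVec y = β • Pi.single (⟨0, by omega⟩ : Fin (m - 1)) 1 :=
    ⟨H⁻¹.mulVec (β • Pi.single (⟨0, by omega⟩ : Fin (m - 1)) 1), by
      rw [Matrix.mulVec_mulVec, Matrix.mul_nonsing_inv _ hHinv, Matrix.one_mulVec]⟩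
  refine ⟨y, -(Hbar.mulVec y ⟨m - 1, by omega⟩), ?_⟩
  have key : Hbar.mulVec y + (-(Hbar.mulVec y ⟨m - 1, by omega⟩)) •
      (Pi.single (⟨m - 1, by omega⟩ : Fin m) (1 : ℝ) : Fin m → ℝ)
      = β • (Pi.single (⟨0, by omega⟩ : Fin m) (1 : ℝ) : Fin m → ℝ) := by
    funext i
    by_cases hi : i.1 < m - 1
    · have h1 : Hbar.mulVec y i = H.mulVec y ⟨i.1, hi⟩ := by
        simp only [Matrix.mulVec, dotProduct, hH]
      have h2 : i ≠ (⟨m - 1, by omega⟩ : Fin m) := by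
        intro h
        rw [h] at hi
        simp at hi
      rw [Pi.add_apply, h1, hy]
      simp only [Pi.smul_apply, Pi.single_apply, h2, if_false, Fin.ext_iff, smul_zero, add_zero]
    · have h2 : i = (⟨m - 1, by omega⟩ : Fin m) := by
        apply Fin.ext
        have := i.2
        simp only
        omega
      rw [h2]
      have h3 : m - 1 ≠ 0 := by omega
      simp [Pi.single_apply, Fin.ext_iff, h3]
  have hb : b = A.mulVec x₀ + β • V.mulVec (Pi.single (⟨0, by omega⟩ : Fin m) 1) := by
    rw [← hr₀]
    abel
  rw [Matrix.mulVec_add, Matrix.mulVec_add, Matrix.mulVec_smul, hzm, Matrix.mulVec_mulVec, hAZ,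
    ← Matrix.mulVec_mulVec, ← Matrix.mulVec_smul, add_assoc, ← Matrix.mulVec_add, key,
    Matrix.mulVec_smul]
  exact hb
end
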